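/- For all n ≥ 0, a_5(11n+10) ≡ 0 (mod 11), where a_5(n) is the number of partitions of n in which even parts may appear in 5 colors. -/

import Mathlib

/-- The set of generalized cubic partitions of `n` with `c` colors for even parts:
a partition is encoded as a multiset of (part, color) pairs, where each part is positive,
even parts carry a color `< c`, and odd parts carry the single color `0`. -/
def cubicPartitionSet (c n : ℕ) : Set (Multiset (ℕ × ℕ)) :=
  {M | (∀ x ∈ M, 0 < x.1 ∧ (if Even x.1 then x.2 < c else x.2 = 0)) ∧
    (M.map Prod.fst).sum = n}

/-- `a c n` is the number of generalized cubic partitions of `n` with `c` colors. -/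
noncomputable def a (c n : ℕ) : ℕ := (cubicPartitionSet c n).ncard

open PowerSeries

/-- Multisets of pairs satisfying `p` whose first components add up to `n`. -/
def weightedMultisets (p : ℕ × ℕ → Prop) (n : ℕ) : Set (Multiset (ℕ × ℕ)) :=
  {M | (∀ x ∈ M, p x) ∧ (M.map Prod.fst).sum = n}

/-- Splitting a multiset according to two disjoint predicates. -/
noncomputable def weightedMultisetsOrEquiv {p q : ℕ × ℕ → Prop} (h : ∀ x, p x → ¬ q x) (n : ℕ) :
    weightedMultisets (fun x ↦ p x ∨ q x) n ≃
      Σ i : Finset.HasAntidiagonal.antidiagonal n,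
        weightedMultisets p i.1.1 × weightedMultisets q i.1.2 := by
  classical
  have hext : ∀ s t : Σ i : Finset.HasAntidiagonal.antidiagonal n,
      weightedMultisets p i.1.1 × weightedMultisets q i.1.2,
      s.2.1.1 = t.2.1.1 → s.2.2.1 = t.2.2.1 → s = t := by
    rintro ⟨⟨⟨i, j⟩, hij⟩, ⟨A, hA, hA'⟩, ⟨B, hB, hB'⟩⟩
      ⟨⟨⟨k, l⟩, hkl⟩, ⟨C, hC, hC'⟩, ⟨D, hD, hD'⟩⟩ hAC hBD
    dsimp only at hA' hB' hC' hD' hAC hBD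
    subst hA' hB' hC' hD' hAC hBD
    rfl
  refine Equiv.ofBijective (fun M ↦ ⟨⟨((M.1.filter p).map Prod.fst |>.sum,
    (M.1.filter (fun x ↦ ¬ p x)).map Prod.fst |>.sum), ?_⟩,
    ⟨M.1.filter p, fun x hx ↦ (Multiset.mem_filter.1 hx).2, rfl⟩,
    ⟨M.1.filter (fun x ↦ ¬ p x), fun x hx ↦ ?_, rfl⟩⟩) ⟨?_, ?_⟩
  · rw [Finset.HasAntidiagonal.mem_antidiagonal, ← Multiset.sum_add, ← Multiset.map_add,
      Multiset.filter_add_not]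
    exact M.2.2
  · obtain ⟨hx, hpx⟩ := Multiset.mem_filter.1 hx
    exact (M.2.1 x hx).resolve_left hpx
  · rintro ⟨M, hM⟩ ⟨N, hN⟩ hMN
    have h1 := congrArg (fun s ↦ s.2.1.1 + s.2.2.1) hMN
    simpa only [Multiset.filter_add_not, Subtype.mk.injEq] using h1
  · rintro ⟨⟨⟨i, j⟩, hij⟩, ⟨A, hA, hA'⟩, ⟨B, hB, hB'⟩⟩
    rw [Finset.HasAntidiagonal.mem_antidiagonal] at hij
    dsimp only at hA' hB' hij
    subst hA' hB'
    have hAB : Multiset.filter p (A + B) = A := by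
      rw [Multiset.filter_add, Multiset.filter_eq_self.2 hA,
        Multiset.filter_eq_nil.2 fun x hx hp ↦ h x hp (hB x hx), add_zero]
    have hAB' : Multiset.filter (fun x ↦ ¬ p x) (A + B) = B := by
      rw [Multiset.filter_add, Multiset.filter_eq_nil.2 fun x hx hp ↦ hp (hA x hx),
        zero_add]
      exact Multiset.filter_eq_self.2 fun x hx hp ↦ h x hp (hB x hx)
    refine ⟨⟨A + B, fun x hx ↦ ?_, ?_⟩, ?_⟩
    · exact (Multiset.mem_add.1 hx).imp (hA x) (hB x)
    · rw [Multiset.map_add, Multiset.sum_add]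
      exact hij
    · exact hext _ _ hAB hAB'

/-- The generating function of `weightedMultisets p`. -/
noncomputable def weightedSeries (R : Type*) [CommRing R] (p : ℕ × ℕ → Prop) : R⟦X⟧ :=
  .mk fun n ↦ (Nat.card (weightedMultisets p n) : R)

section

variable {p q : ℕ × ℕ → Prop}

theorem finite_weightedMultisets_or (h : ∀ x, p x → ¬ q x)
    (hp : ∀ n, Finite (weightedMultisets p n)) (hq : ∀ n, Finite (weightedMultisets q n))
    (n : ℕ) : Finite (weightedMultisets (fun x ↦ p x ∨ q x) n) :=
  Finite.of_equiv _ (weightedMultisetsOrEquiv h n).symm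

theorem weightedSeries_or (R : Type*) [CommRing R] (h : ∀ x, p x → ¬ q x)
    (hp : ∀ n, Finite (weightedMultisets p n)) (hq : ∀ n, Finite (weightedMultisets q n)) :
    weightedSeries R (fun x ↦ p x ∨ q x) = weightedSeries R p * weightedSeries R q := by
  ext n
  simp only [weightedSeries, coeff_mul, coeff_mk]
  rw [Nat.card_congr (weightedMultisetsOrEquiv h n), Nat.card_sigma]
  push_cast [Nat.card_prod]
  exact Finset.sum_coe_sort (Finset.HasAntidiagonal.antidiagonal n) (fun i ↦
    (Nat.card (weightedMultisets p i.1) : R) * Nat.card (weightedMultisets q i.2))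

end

/-- The pairs whose first component is a positive multiple of `d`, with second component `c`. -/
def IsMultipleColored (d c : ℕ) (x : ℕ × ℕ) : Prop := 0 < x.1 ∧ d ∣ x.1 ∧ x.2 = c

/-- Scaling the parts of a partition by `d` and giving them the color `c`. -/
noncomputable def partitionEquivWeightedMultisets {d : ℕ} (hd : 0 < d) (c n : ℕ) :
    n.Partition ≃ weightedMultisets (IsMultipleColored d c) (d * n) := by
  have hsum : ∀ s : Multiset ℕ, ((s.map fun k ↦ (d * k, c)).map Prod.fst).sum = d * s.sum := by
    intro s
    rw [Multiset.map_map]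
    exact Multiset.sum_map_mul_left (s := s) (f := fun k ↦ k) (a := d) |>.trans (by simp)
  refine Equiv.ofBijective (fun P ↦ ⟨P.parts.map fun k ↦ (d * k, c), fun x hx ↦ ?_, ?_⟩) ⟨?_, ?_⟩
  · obtain ⟨k, hk, rfl⟩ := Multiset.mem_map.1 hx
    exact ⟨Nat.mul_pos hd (P.parts_pos hk), dvd_mul_right _ _, rfl⟩
  · rw [hsum, P.parts_sum]
  · intro P Q hPQ
    have hinj : Function.Injective fun k : ℕ ↦ (d * k, c) := fun k l hkl ↦
      Nat.eq_of_mul_eq_mul_left hd (Prod.mk.inj hkl).1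
    exact Nat.Partition.ext (Multiset.map_injective hinj (Subtype.mk.inj hPQ))
  · rintro ⟨M, hM, hMn⟩
    have hmap : (M.map fun x ↦ x.1 / d).map (fun k ↦ (d * k, c)) = M := by
      rw [Multiset.map_map]
      conv_rhs => rw [← Multiset.map_id M]
      refine Multiset.map_congr rfl fun x hx ↦ ?_
      obtain ⟨-, h1, h2⟩ := hM x hx
      exact Prod.ext (Nat.mul_div_cancel' h1) h2.symm
    refine ⟨⟨M.map fun x ↦ x.1 / d, ?_, ?_⟩, Subtype.ext hmap⟩
    · intro k hk
      obtain ⟨x, hx, rfl⟩ := Multiset.mem_map.1 hk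
      obtain ⟨h1, h2, -⟩ := hM x hx
      exact Nat.div_pos (Nat.le_of_dvd h1 h2) hd
    · refine Nat.eq_of_mul_eq_mul_left hd ?_
      rw [← hsum, hmap, hMn]

theorem isEmpty_weightedMultisets_isMultipleColored {d n : ℕ} (c : ℕ) (h : ¬ d ∣ n) :
    IsEmpty (weightedMultisets (IsMultipleColored d c) n) := by
  refine ⟨fun ⟨M, hM, hMn⟩ ↦ h ?_⟩
  rw [← hMn]
  refine Multiset.dvd_sum fun k hk ↦ ?_
  obtain ⟨x, hx, rfl⟩ := Multiset.mem_map.1 hk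
  exact (hM x hx).2.1

theorem finite_weightedMultisets_isMultipleColored {d : ℕ} (hd : 0 < d) (c n : ℕ) :
    Finite (weightedMultisets (IsMultipleColored d c) n) := by
  by_cases h : d ∣ n
  · obtain ⟨m, rfl⟩ := h
    exact Finite.of_equiv _ (partitionEquivWeightedMultisets hd c m)
  · have := isEmpty_weightedMultisets_isMultipleColored c h
    infer_instance

/-- The generating function of the partition numbers. -/
noncomputable def partitionSeries (R : Type*) [CommRing R] : R⟦X⟧ :=
  .mk fun n ↦ (Fintype.card n.Partition : R)

theorem weightedSeries_isMultipleColored (R : Type*) [CommRing R] {d : ℕ} (hd : d ≠ 0) (c : ℕ) :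
    weightedSeries R (IsMultipleColored d c) = (partitionSeries R).expand d hd := by
  ext n
  rw [coeff_expand, weightedSeries, coeff_mk]
  split_ifs with h
  · obtain ⟨m, rfl⟩ := h
    rw [Nat.mul_div_cancel_left m (Nat.pos_of_ne_zero hd), partitionSeries, coeff_mk,
      ← Nat.card_congr (partitionEquivWeightedMultisets (Nat.pos_of_ne_zero hd) c m),
      Nat.card_eq_fintype_card]
  · have := isEmpty_weightedMultisets_isMultipleColored c h
    simp

open scoped PowerSeries.WithPiTopology in
theorem partitionSeries_mul_pentagonalSeries (R : Type*) [CommRing R] :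
    partitionSeries R * pentagonalSeries R = 1 := by
  let : TopologicalSpace R := ⊥
  have : DiscreteTopology R := ⟨rfl⟩
  have h1 := Nat.Partition.hasProd_powerSeriesMk_card_restricted R (fun _ ↦ True)
  have h2 := h1.mul (WithPiTopology.hasProd_one_sub_X_pow R)
  have h3 : (PowerSeries.mk fun n ↦ ((Nat.Partition.restricted n fun _ ↦ True).card : R)) =
      partitionSeries R := by
    simp [partitionSeries, Nat.Partition.restricted, Finset.card_univ]
  rw [h3] at h2
  refine h2.unique ?_
  convert! hasProd_one with i
  simp_rw [if_true, pow_mul]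
  exact WithPiTopology.tsum_pow_mul_one_sub_of_constantCoeff_eq_zero (by simp)

/-- The generating function of the partitions with even parts in five colors. -/
theorem mk_a_five (R : Type*) [CommRing R] :
    (PowerSeries.mk fun n ↦ (a 5 n : R)) =
      partitionSeries R * (partitionSeries R).expand 2 two_ne_zero ^ 4 := by
  have h2 := fun c ↦ finite_weightedMultisets_isMultipleColored two_pos c
  have h1 := fun c ↦ finite_weightedMultisets_isMultipleColored one_pos c
  have e2 := weightedSeries_isMultipleColored R two_ne_zero
  have e1 := weightedSeries_isMultipleColored R one_ne_zero 0
  rw [expand_one_apply] at e1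
  have d4 : ∀ x, IsMultipleColored 2 3 x → ¬ IsMultipleColored 2 4 x := by
    grind [IsMultipleColored]
  have d3 : ∀ x, IsMultipleColored 2 2 x →
      ¬ (IsMultipleColored 2 3 x ∨ IsMultipleColored 2 4 x) := by
    grind [IsMultipleColored]
  have d2 : ∀ x, IsMultipleColored 2 1 x → ¬ (IsMultipleColored 2 2 x ∨
      IsMultipleColored 2 3 x ∨ IsMultipleColored 2 4 x) := by
    grind [IsMultipleColored]
  have d1 : ∀ x, IsMultipleColored 1 0 x → ¬ (IsMultipleColored 2 1 x ∨
      IsMultipleColored 2 2 x ∨ IsMultipleColored 2 3 x ∨ IsMultipleColored 2 4 x) := by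
    grind [IsMultipleColored]
  have f4 := finite_weightedMultisets_or d4 (h2 3) (h2 4)
  have f3 := finite_weightedMultisets_or d3 (h2 2) f4
  have f2 := finite_weightedMultisets_or d2 (h2 1) f3
  have key := weightedSeries_or R d1 (h1 0) f2
  rw [weightedSeries_or R d2 (h2 1) f3, weightedSeries_or R d3 (h2 2) f4,
    weightedSeries_or R d4 (h2 3) (h2 4), e1, e2, e2, e2, e2] at key
  rw [show ∀ x y : R⟦X⟧, x * y ^ 4 = x * (y * (y * (y * y))) from fun x y ↦ by ring, ← key]
  ext n
  rw [weightedSeries, coeff_mk, coeff_mk, a, ← Nat.card_coe_set_eq]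
  congr 3
  ext M
  refine and_congr (forall₂_congr fun x _ ↦ ?_) Iff.rfl
  simp only [IsMultipleColored, ← even_iff_two_dvd]
  split_ifs with h <;> simp only [h] <;> grind

theorem mk_a_five_mul (R : Type*) [CommRing R] :
    (PowerSeries.mk fun n ↦ (a 5 n : R)) *
      (pentagonalSeries R * (pentagonalSeries R).expand 2 two_ne_zero ^ 4) = 1 := by
  have h := partitionSeries_mul_pentagonalSeries R
  have h2 := congrArg (expand 2 two_ne_zero) h
  rw [map_mul, map_one] at h2
  rw [mk_a_five, mul_mul_mul_comm, h, ← mul_pow, h2, one_pow, one_mul]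
/-- Gaussian binomial coefficients. -/
def gaussBinom {S : Type*} [CommRing S] (q : S) : ℕ → ℕ → S
  | _, 0 => 1
  | 0, _ + 1 => 0
  | n + 1, k + 1 => gaussBinom q n k + q ^ (k + 1) * gaussBinom q n (k + 1)

/-- The triangular number `j * (j - 1) / 2` of an integer `j`. -/
def triangular (j : ℤ) : ℕ := (j * (j - 1) / 2).toNat

theorem two_mul_natCast_triangular (j : ℤ) : 2 * (triangular j : ℤ) = j * (j - 1) := by
  have h0 : 0 ≤ j * (j - 1) := by
    rcases le_or_gt j 0 with h | h <;> nlinarith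
  rw [triangular, Int.toNat_of_nonneg (by omega)]
  exact Int.two_mul_ediv_two_of_even (Int.even_mul_pred_self j)

theorem abs_le_triangular_add_one (j : ℤ) : |j| ≤ triangular j + 1 := by
  have h := two_mul_natCast_triangular j
  rcases le_or_gt j 0 with hj | hj
  · rw [abs_of_nonpos hj]
    nlinarith
  · rw [abs_of_pos hj]
    nlinarith [sq_nonneg (2 * j - 3)]

section GaussBinom

variable {S : Type*} [CommRing S] (q : S)

@[simp]
theorem gaussBinom_zero_right (n : ℕ) : gaussBinom q n 0 = 1 := by
  cases n <;> rfl

theorem gaussBinom_succ_succ (n k : ℕ) :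
    gaussBinom q (n + 1) (k + 1) = gaussBinom q n k + q ^ (k + 1) * gaussBinom q n (k + 1) := rfl

theorem gaussBinom_eq_zero_of_lt {n k : ℕ} (h : n < k) : gaussBinom q n k = 0 := by
  induction n generalizing k with
  | zero =>
    obtain ⟨k, rfl⟩ := Nat.exists_eq_succ_of_ne_zero h.ne'
    rfl
  | succ n ih =>
    obtain ⟨k, rfl⟩ := Nat.exists_eq_succ_of_ne_zero (Nat.ne_zero_of_lt h)
    rw [Nat.succ_eq_add_one, gaussBinom_succ_succ, ih (by omega), ih (by omega)]
    ring

theorem gaussBinom_self (n : ℕ) : gaussBinom q n n = 1 := by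
  induction n with
  | zero => rfl
  | succ n ih => rw [gaussBinom_succ_succ, ih, gaussBinom_eq_zero_of_lt q n.lt_succ_self]; ring

theorem map_gaussBinom {S' : Type*} [CommRing S'] (f : S →+* S') (n k : ℕ) :
    f (gaussBinom q n k) = gaussBinom (f q) n k := by
  induction n generalizing k with
  | zero => cases k <;> simp [gaussBinom]
  | succ n ih => cases k <;> simp [gaussBinom, ih]

/-- The finite product `(1 - q) (1 - q ^ 2) ⋯ (1 - q ^ n)`. -/
def qFactorial (n : ℕ) : S := ∏ k ∈ Finset.range n, (1 - q ^ (k + 1))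

theorem qFactorial_succ (n : ℕ) :
    qFactorial q (n + 1) = qFactorial q n * (1 - q ^ (n + 1)) :=
  Finset.prod_range_succ _ _

theorem gaussBinom_mul_qFactorial (i l : ℕ) :
    gaussBinom q (i + l) i * qFactorial q i * qFactorial q l = qFactorial q (i + l) := by
  induction h : i + l generalizing i l with
  | zero =>
    obtain ⟨rfl, rfl⟩ := Nat.add_eq_zero_iff.1 h
    simp [qFactorial]
  | succ m ih =>
    rcases i with _ | i
    · obtain rfl : l = m + 1 := by omega
      simp [qFactorial]
    rcases l with _ | l
    · obtain rfl : i = m := by omega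
      simp [qFactorial, gaussBinom_self]
    have h1 := ih i (l + 1) (by omega)
    have h2 := ih (i + 1) l (by omega)
    obtain rfl : m = i + l + 1 := by omega
    rw [gaussBinom_succ_succ]
    rw [qFactorial_succ q (i + l + 1), qFactorial_succ q i, qFactorial_succ q l] at *
    linear_combination (1 - q ^ (i + 1)) * h1 + q ^ (i + 1) * (1 - q ^ (l + 1)) * h2

/-- The homogeneous `q`-binomial theorem. -/
theorem prod_add_mul_pow (x y : S) (m : ℕ) :
    ∏ k ∈ Finset.range m, (y + x * q ^ k) =
      ∑ i ∈ Finset.range (m + 1), gaussBinom q m i * q ^ i.choose 2 * x ^ i * y ^ (m - i) := by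
  induction m generalizing x with
  | zero => simp
  | succ m ih =>
    have h1 : ∏ k ∈ Finset.range m, (y + x * q ^ (k + 1)) =
        ∏ k ∈ Finset.range m, (y + x * q * q ^ k) :=
      Finset.prod_congr rfl fun k _ ↦ by ring
    have h2 : ∑ i ∈ Finset.range (m + 1),
          q ^ (i + 1) * gaussBinom q m (i + 1) * q ^ (i + 1).choose 2 * x ^ (i + 1) * y ^ (m - i) +
          y ^ (m + 1) =
        ∑ i ∈ Finset.range (m + 1),
          q ^ i * gaussBinom q m i * q ^ i.choose 2 * x ^ i * y ^ (m + 1 - i) := by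
      have h3 := Finset.sum_range_succ' (fun i ↦
        q ^ i * gaussBinom q m i * q ^ i.choose 2 * x ^ i * y ^ (m + 1 - i)) (m + 1)
      rw [Finset.sum_range_succ, gaussBinom_eq_zero_of_lt q m.lt_succ_self] at h3
      simpa using h3.symm
    rw [Finset.prod_range_succ', h1, ih, Finset.sum_range_succ' _ (m + 1)]
    simp only [gaussBinom_succ_succ, Nat.add_sub_add_right, add_mul, Finset.sum_add_distrib]
    simp only [gaussBinom_zero_right, Nat.choose_zero_succ, pow_zero, mul_one, one_mul,
      Nat.sub_zero]
    rw [add_assoc, h2, mul_add, Finset.sum_mul, Finset.sum_mul, add_comm]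
    congr 1
    · refine Finset.sum_congr rfl fun i _ ↦ ?_
      rw [show (i + 1).choose 2 = i + i.choose 2 by rw [Nat.choose_succ_succ' i 1]; simp]
      ring
    · refine Finset.sum_congr rfl fun i hi ↦ ?_
      rw [Nat.sub_add_comm (Finset.mem_range_succ_iff.1 hi), pow_succ]
      ring

theorem two_mul_natCast_choose_two (n : ℕ) : 2 * (n.choose 2 : ℤ) = n * (n - 1) := by
  induction n with
  | zero => simp
  | succ n ih =>
    rw [Nat.choose_succ_succ' n 1, Nat.choose_one_right]
    push_cast
    linear_combination ih

/-- The finite form of the Jacobi triple product identity. -/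
theorem finite_jacobi_triple_product [IsDomain S] (hq : q ≠ 0) (z : S) (n : ℕ) :
    (∏ k ∈ Finset.range n, (q ^ (k + 1) - z)) * ∏ k ∈ Finset.range n, (1 - z * q ^ k) =
      ∑ i ∈ Finset.range (2 * n + 1),
        gaussBinom q (2 * n) i * q ^ triangular (i - n) * (-z) ^ i := by
  have h := prod_add_mul_pow q (-z) (q ^ n) (2 * n)
  have h1 : ∏ k ∈ Finset.range n, (q ^ n + -z * q ^ k) =
      q ^ n.choose 2 * ∏ k ∈ Finset.range n, (q ^ (k + 1) - z) := by
    rw [Nat.choose_two_right, ← Finset.sum_range_id, ← Finset.prod_pow_eq_pow_sum,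
      ← Finset.prod_range_reflect, ← Finset.prod_range_reflect (fun k ↦ q ^ k),
      ← Finset.prod_mul_distrib]
    refine Finset.prod_congr rfl fun k hk ↦ ?_
    obtain ⟨l, rfl⟩ := Nat.exists_eq_add_of_lt (Finset.mem_range.1 hk)
    rw [show k + l + 1 - 1 - k = l by omega]
    ring
  have h2 : ∏ k ∈ Finset.range n, (q ^ n + -z * q ^ (n + k)) =
      q ^ (n * n) * ∏ k ∈ Finset.range n, (1 - z * q ^ k) := by
    have h3 : q ^ (n * n) = ∏ _k ∈ Finset.range n, q ^ n := by simp [pow_mul]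
    rw [h3, ← Finset.prod_mul_distrib]
    exact Finset.prod_congr rfl fun k _ ↦ by ring
  rw [two_mul, Finset.prod_range_add, h1, h2, ← two_mul] at h
  refine mul_left_cancel₀ (pow_ne_zero (n.choose 2 + n * n) hq) ?_
  rw [Finset.mul_sum]
  refine Eq.trans ?_ (h.trans (Finset.sum_congr rfl fun i hi ↦ ?_))
  · ring
  · have h3 : i.choose 2 + n * (2 * n - i) = n.choose 2 + n * n + triangular (i - n) := by
      zify [Finset.mem_range_succ_iff.1 hi]
      have e1 := two_mul_natCast_choose_two i
      have e2 := two_mul_natCast_choose_two n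
      have e3 := two_mul_natCast_triangular (i - n)
      refine mul_left_cancel₀ two_ne_zero (M₀ := ℤ) ?_
      linear_combination e1 - e2 - e3
    rw [← pow_mul, show gaussBinom q (2 * n) i * q ^ i.choose 2 * (-z) ^ i * q ^ (n * (2 * n - i)) =
      gaussBinom q (2 * n) i * (-z) ^ i * q ^ (i.choose 2 + n * (2 * n - i)) by ring, h3]
    ring

end GaussBinom
section Truncation

variable {R : Type*} [CommRing R]

/-- Reduction of power series modulo `X ^ N`. -/
noncomputable abbrev modXPow (R : Type*) [CommRing R] (N : ℕ) :
    R⟦X⟧ →+* R⟦X⟧ ⧸ Ideal.span {(X : R⟦X⟧) ^ N} :=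
  Ideal.Quotient.mk _

theorem modXPow_eq_iff {N : ℕ} {f g : R⟦X⟧} :
    modXPow R N f = modXPow R N g ↔ ∀ d < N, coeff d f = coeff d g := by
  rw [Ideal.Quotient.mk_eq_mk_iff_sub_mem, Ideal.mem_span_singleton, X_pow_dvd_iff]
  simp only [map_sub, sub_eq_zero]

theorem eq_of_forall_modXPow {f g : R⟦X⟧} (h : ∀ N, modXPow R N f = modXPow R N g) : f = g := by
  ext d
  exact modXPow_eq_iff.1 (h (d + 1)) d d.lt_succ_self

theorem modXPow_monomial_eq_zero {N e : ℕ} (h : N ≤ e) (r : R) :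
    modXPow R N (monomial e r) = 0 := by
  rw [← map_zero (modXPow R N), modXPow_eq_iff]
  intro d hd
  rw [coeff_monomial, if_neg (by omega), map_zero]

theorem modXPow_qFactorial_X {N n : ℕ} (h : N ≤ n) :
    modXPow R N (qFactorial X n) = modXPow R N (pentagonalSeries R) := by
  rw [modXPow_eq_iff]
  intro d hd
  obtain ⟨s, hs, hsn⟩ := ((coeff_prod_one_sub_X_pow_eventually_eq R d).and
    (Filter.eventually_ge_atTop (Finset.range n))).exists
  rw [← hs, qFactorial, ← Finset.prod_sdiff hsn]
  refine modXPow_eq_iff.1 ?_ d hd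
  have h1 : modXPow R N (∏ k ∈ s \ Finset.range n, (1 - X ^ (k + 1))) = 1 := by
    rw [map_prod]
    refine Finset.prod_eq_one fun k hk ↦ ?_
    have hk' : n ≤ k := by simpa using (Finset.mem_sdiff.1 hk).2
    have h2 : modXPow R N (X ^ (k + 1)) = 0 :=
      X_pow_eq (R := R) (k + 1) ▸ modXPow_monomial_eq_zero (by omega) 1
    rw [map_sub, map_one, h2, sub_zero]
  rw [map_mul, h1, one_mul]

theorem modXPow_qFactorial {N n d : ℕ} (hd : d ≠ 0) (h : N ≤ n) :
    modXPow R N (qFactorial (X ^ d) n) = modXPow R N ((pentagonalSeries R).expand d hd) := by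
  have h1 : qFactorial (X ^ d) n = (qFactorial (X : R⟦X⟧) n).expand d hd := by
    simp [qFactorial]
  rw [h1, modXPow_eq_iff]
  intro m hm
  rw [coeff_expand, coeff_expand]
  split_ifs with hdm
  · exact modXPow_eq_iff.1 (modXPow_qFactorial_X h) _ ((Nat.div_le_self m d).trans_lt hm)
  · rfl

theorem modXPow_gaussBinom {N d i l : ℕ} (hd : d ≠ 0) (hi : N ≤ i) (hl : N ≤ l) :
    modXPow R N ((pentagonalSeries R).expand d hd * gaussBinom (X ^ d) (i + l) i) = 1 := by
  have h := congrArg (modXPow R N) (gaussBinom_mul_qFactorial (X ^ d : R⟦X⟧) i l)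
  rw [map_mul, map_mul, modXPow_qFactorial hd hi, modXPow_qFactorial hd hl,
    modXPow_qFactorial hd (hi.trans (Nat.le_add_right i l))] at h
  have h2 := congrArg (modXPow R N) (congrArg (expand d hd)
    (partitionSeries_mul_pentagonalSeries R))
  rw [map_mul, map_mul, map_one, map_one] at h2
  rw [map_mul]
  linear_combination modXPow R N ((partitionSeries R).expand d hd) * h +
    (1 - modXPow R N ((pentagonalSeries R).expand d hd) *
      modXPow R N (gaussBinom (X ^ d) (i + l) i)) * h2

open scoped PowerSeries.WithPiTopology

variable [TopologicalSpace R] [DiscreteTopology R]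

theorem modXPow_hasSum {e : ℤ → ℕ} (he : ∀ j, |j| ≤ e j + 1) {u : ℤ → R} {F : R⟦X⟧}
    (hF : HasSum (fun j ↦ monomial (e j) (u j)) F) {N n : ℕ} (hn : N ≤ n) :
    modXPow R N F = ∑ i ∈ Finset.range (2 * n + 1),
      modXPow R N (monomial (e (i - n)) (u (i - n))) := by
  rw [← map_sum, modXPow_eq_iff]
  intro d hd
  have h1 := (WithPiTopology.hasSum_iff_hasSum_coeff R).1 hF d
  have hinj : Function.Injective fun i : ℕ ↦ (i - n : ℤ) := fun i k hik ↦ by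
    simpa using hik
  refine h1.unique ?_
  rw [map_sum]
  refine Eq.subst (motive := fun S ↦ HasSum _ S) (Finset.sum_map _ ⟨_, hinj⟩
    fun j : ℤ ↦ coeff d (monomial (e j) (u j))) ?_
  refine hasSum_sum_of_ne_finset_zero fun j hj ↦ ?_
  rw [coeff_monomial, if_neg]
  rintro rfl
  refine hj (Finset.mem_map.2 ⟨(j + n).toNat, ?_, ?_⟩)
  · have := abs_le.1 (he j)
    rw [Finset.mem_range]
    omega
  · have := abs_le.1 (he j)
    simp only [Function.Embedding.coeFn_mk]
    omega

/-- Multiplying by the Euler product removes the Gaussian binomials from a truncated theta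
series. -/
theorem modXPow_expand_mul_sum_gaussBinom {e : ℤ → ℕ} (he : ∀ j, |j| ≤ e j + 1) {u : ℤ → R}
    {F : R⟦X⟧} (hF : HasSum (fun j ↦ monomial (e j) (u j)) F) {N n d : ℕ} (hd : d ≠ 0)
    (hn : 2 * N ≤ n) :
    modXPow R N ((pentagonalSeries R).expand d hd * ∑ i ∈ Finset.range (2 * n + 1),
      gaussBinom (X ^ d) (2 * n) i * monomial (e (i - n)) (u (i - n))) = modXPow R N F := by
  rw [modXPow_hasSum he hF (show N ≤ n by omega), Finset.mul_sum, map_sum]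
  refine Finset.sum_congr rfl fun i hi ↦ ?_
  obtain ⟨l, hl⟩ := Nat.exists_eq_add_of_le (Finset.mem_range_succ_iff.1 hi)
  rw [← mul_assoc, map_mul]
  by_cases h : N ≤ e (i - n)
  · rw [modXPow_monomial_eq_zero h, mul_zero]
  · have := abs_le.1 (he (i - n))
    rw [hl, modXPow_gaussBinom hd (by omega) (by omega), one_mul]

end Truncation

section Theta

theorem abs_le_natAbs_sq_add_one (j : ℤ) : |j| ≤ (j.natAbs ^ 2 : ℕ) + 1 := by
  push_cast
  rw [sq_abs]
  exact abs_le.2 ⟨by nlinarith, by nlinarith⟩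

theorem negOnePow_natCast_sub (R : Type*) [CommRing R] (i n : ℕ) :
    ((Int.negOnePow (i - n) : ℤ) : R) = (-1) ^ n * (-1) ^ i := by
  rw [Int.negOnePow_sub]
  simp [mul_comm]

theorem prod_one_sub_pow_odd_mul_qFactorial {S : Type*} [CommRing S] (q : S) (n : ℕ) :
    (∏ k ∈ Finset.range n, (1 - q ^ (2 * k + 1))) * qFactorial (q ^ 2) n =
      qFactorial q (2 * n) := by
  induction n with
  | zero => simp [qFactorial]
  | succ n ih =>
    rw [show 2 * (n + 1) = 2 * n + 1 + 1 by ring, qFactorial_succ, qFactorial_succ, qFactorial_succ,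
      Finset.prod_range_succ, ← ih]
    ring

open scoped PowerSeries.WithPiTopology

variable {R : Type*} [CommRing R] [IsDomain R] [TopologicalSpace R] [DiscreteTopology R]

/-- Gauss's theta series identity. -/
theorem gauss_theta_mul {F : R⟦X⟧}
    (hF : HasSum (fun j : ℤ ↦ monomial (j.natAbs ^ 2) ((j.negOnePow : ℤ) : R)) F) :
    F * (pentagonalSeries R).expand 2 two_ne_zero = pentagonalSeries R ^ 2 := by
  refine eq_of_forall_modXPow fun N ↦ ?_
  set n := 2 * N
  set O : R⟦X⟧ := ∏ k ∈ Finset.range n, (1 - X ^ (2 * k + 1))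
  have h1 := modXPow_expand_mul_sum_gaussBinom abs_le_natAbs_sq_add_one hF two_ne_zero
    (le_refl (2 * N))
  have h2 : O ^ 2 = ∑ i ∈ Finset.range (2 * n + 1), gaussBinom (X ^ 2) (2 * n) i *
      monomial ((i - n : ℤ).natAbs ^ 2) ((Int.negOnePow (i - n) : ℤ) : R) := by
    have h := finite_jacobi_triple_product (X ^ 2 : R⟦X⟧) (pow_ne_zero 2 X_ne_zero) X n
    have h3 : ∏ k ∈ Finset.range n, ((X ^ 2 : R⟦X⟧) ^ (k + 1) - X) = (-X) ^ n * O := by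
      rw [← Finset.card_range n, ← Finset.prod_const, Finset.card_range,
        ← Finset.prod_mul_distrib]
      exact Finset.prod_congr rfl fun k _ ↦ by ring
    have h4 : ∏ k ∈ Finset.range n, (1 - X * (X ^ 2 : R⟦X⟧) ^ k) = O :=
      Finset.prod_congr rfl fun k _ ↦ by ring
    rw [h3, h4] at h
    refine mul_left_cancel₀ (pow_ne_zero n (neg_ne_zero.2 (X_ne_zero (R := R)))) ?_
    rw [sq, ← mul_assoc, h, Finset.mul_sum]
    refine Finset.sum_congr rfl fun i _ ↦ ?_
    have h5 : 2 * triangular (i - n) + i = n + (i - n : ℤ).natAbs ^ 2 := by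
      zify
      rw [sq_abs, two_mul_natCast_triangular]
      ring
    rw [negOnePow_natCast_sub R, monomial_eq_C_mul_X_pow, map_mul, map_pow, map_pow, map_neg,
      map_one, neg_pow X i, neg_pow X n, ← pow_mul]
    have h6 : ((-1 : R⟦X⟧) ^ n) ^ 2 = 1 := by rw [← pow_mul, mul_comm, pow_mul]; simp
    calc _ = gaussBinom (X ^ 2 : R⟦X⟧) (2 * n) i * (-1) ^ i *
          X ^ (2 * triangular (i - n) + i) := by ring
      _ = _ := by
        rw [h5, pow_add]
        linear_combination -(gaussBinom (X ^ 2 : R⟦X⟧) (2 * n) i * (-1) ^ i *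
          (X ^ n * X ^ (i - n : ℤ).natAbs ^ 2)) * h6
  have h3 : O * qFactorial (X ^ 2) n = qFactorial X (2 * n) :=
    prod_one_sub_pow_odd_mul_qFactorial X n
  have h4 := congrArg (modXPow R N) h3
  rw [map_mul, modXPow_qFactorial two_ne_zero (by omega), modXPow_qFactorial_X (by omega)] at h4
  rw [← h2, map_mul, map_pow] at h1
  rw [map_mul, map_pow, ← h1, ← h4]
  ring

/-- Jacobi's identity for the cube of the Euler product. -/
theorem jacobi_pow_three {F : R⟦X⟧}
    (hF : HasSum (fun j : ℤ ↦ monomial (triangular j) ((j.negOnePow : ℤ) * j : R)) F) :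
    F = -pentagonalSeries R ^ 3 := by
  refine eq_of_forall_modXPow fun N ↦ ?_
  set n := 2 * N + 1
  have h1 := modXPow_expand_mul_sum_gaussBinom abs_le_triangular_add_one hF one_ne_zero
    (show 2 * N ≤ n by omega)
  have h2 : ∑ i ∈ Finset.range (2 * n + 1), gaussBinom (X ^ 1) (2 * n) i *
      monomial (triangular (i - n)) ((Int.negOnePow (i - n) : ℤ) * ((i - n : ℤ) : R) : R) =
      - (qFactorial X n * qFactorial X (2 * N)) := by
    have h := finite_jacobi_triple_product (Polynomial.C (X : R⟦X⟧))
      (Polynomial.C_ne_zero.2 X_ne_zero) Polynomial.X n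
    rw [Finset.prod_range_succ' (fun k ↦ 1 - Polynomial.X * Polynomial.C (X : R⟦X⟧) ^ k) (2 * N),
      pow_zero, mul_one, ← mul_assoc] at h
    have h0 : ∀ i, gaussBinom (Polynomial.C (X : R⟦X⟧)) (2 * n) i *
        Polynomial.C X ^ triangular (i - n) * (-Polynomial.X) ^ i =
        Polynomial.C (gaussBinom X (2 * n) i * X ^ triangular (i - n) * (-1) ^ i) *
          Polynomial.X ^ i := fun i ↦ by
      rw [← map_gaussBinom, neg_pow]
      simp only [map_mul, map_pow, map_neg, map_one]
      ring
    simp only [h0] at h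
    have h3 := congrArg (Polynomial.eval 1) h
    have h4 := congrArg (fun p ↦ Polynomial.eval 1 (Polynomial.derivative p)) h
    have h5 : ∏ k ∈ Finset.range n, ((X : R⟦X⟧) ^ (k + 1) - 1) = (-1) ^ n * qFactorial X n := by
      rw [qFactorial, ← Finset.card_range n, ← Finset.prod_const, Finset.card_range,
        ← Finset.prod_mul_distrib]
      exact Finset.prod_congr rfl fun k _ ↦ by ring
    simp only [Polynomial.eval_mul, Polynomial.eval_finsetSum, Polynomial.eval_prod,
      Polynomial.derivative_mul, Polynomial.derivative_sum, Polynomial.eval_sub,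
      Polynomial.eval_X, Polynomial.eval_pow, Polynomial.eval_C, Polynomial.eval_add,
      Polynomial.eval_one, Polynomial.derivative_sub, Polynomial.derivative_one,
      Polynomial.derivative_X, Polynomial.derivative_X_pow, Polynomial.derivative_C,
      Polynomial.eval_neg, sub_self, mul_zero, zero_add, zero_sub, one_pow, mul_one, one_mul,
      zero_mul, h5] at h3 h4
    have h6 : ((-1 : R⟦X⟧) ^ n) ^ 2 = 1 := by rw [← pow_mul, mul_comm, pow_mul]; simp
    have h7 : ∀ i : ℕ, gaussBinom ((X : R⟦X⟧) ^ 1) (2 * n) i *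
        monomial (triangular (i - n)) ((Int.negOnePow (i - n) : ℤ) * ((i - n : ℤ) : R) : R) =
        (-1) ^ n * (gaussBinom (X : R⟦X⟧) (2 * n) i * X ^ triangular (i - n) * (-1) ^ i *
          (i : R⟦X⟧)) -
        (-1) ^ n * (n : R⟦X⟧) *
          (gaussBinom (X : R⟦X⟧) (2 * n) i * X ^ triangular (i - n) * (-1) ^ i) := fun i ↦ by
      rw [negOnePow_natCast_sub R, monomial_eq_C_mul_X_pow]
      simp only [map_mul, map_pow, map_neg, map_one, pow_one, Int.cast_sub, map_sub,
        Int.cast_natCast, map_natCast]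
      ring
    simp only [h7, Finset.sum_sub_distrib, ← Finset.mul_sum]
    rw [← h3, ← h4]
    simp only [qFactorial] at *
    linear_combination -((∏ k ∈ Finset.range n, (1 - (X : R⟦X⟧) ^ (k + 1))) *
      ∏ k ∈ Finset.range (2 * N), (1 - (X : R⟦X⟧) ^ (k + 1))) * h6
  rw [expand_one_apply, h2, map_mul, map_neg, map_mul, modXPow_qFactorial_X (by omega),
    modXPow_qFactorial_X (by omega)] at h1
  rw [← h1, map_neg, map_pow]
  ring

end Theta
section Quintuple

open scoped PowerSeries.WithPiTopology

variable {R : Type*} [CommRing R] [TopologicalSpace R]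

theorem summable_monomial {ι : Type*} {e : ι → ℕ} (he : ∀ d, {i | e i = d}.Finite) (u : ι → R) :
    Summable fun i ↦ monomial (e i) (u i) := by
  refine (WithPiTopology.summable_iff_summable_coeff R).2 fun d ↦ ?_
  refine summable_of_hasFiniteSupport ((he d).subset fun i hi ↦ ?_)
  by_contra h
  exact hi ((coeff_monomial d (e i) (u i)).trans (if_neg (Ne.symm h)))

theorem finite_setOf_eq_of_abs_le {e : ℤ → ℕ} (he : ∀ j, |j| ≤ e j + 1) (d : ℕ) :
    {j | e j = d}.Finite := by
  refine (Set.finite_Icc (-(d + 1) : ℤ) (d + 1)).subset fun j hj ↦ ?_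
  have := abs_le.1 (he j)
  rw [Set.mem_ofPred_eq] at hj
  rw [Set.mem_Icc]
  omega

theorem finite_setOf_add_eq_of_abs_le {e e' : ℤ → ℕ} (he : ∀ j, |j| ≤ e j + 1)
    (he' : ∀ j, |j| ≤ e' j + 1) (d : ℕ) : {p : ℤ × ℤ | e p.1 + e' p.2 = d}.Finite := by
  refine ((Set.finite_Icc (-(d + 1) : ℤ) (d + 1)).prod
    (Set.finite_Icc (-(d + 1) : ℤ) (d + 1))).subset fun p hp ↦ ?_
  have h1 := abs_le.1 (he p.1)
  have h2 := abs_le.1 (he' p.2)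
  rw [Set.mem_ofPred_eq] at hp
  rw [Set.mem_prod, Set.mem_Icc, Set.mem_Icc]
  omega

theorem hasSum_expand_pentagonalSeries {d : ℕ} (hd : d ≠ 0) :
    HasSum (fun j : ℤ ↦ monomial (d * pentagonal j) ((j.negOnePow : ℤ) : R))
      ((pentagonalSeries R).expand d hd) := by
  refine (WithPiTopology.hasSum_iff_hasSum_coeff R).2 fun m ↦ ?_
  rw [coeff_expand]
  split_ifs with h
  · obtain ⟨m, rfl⟩ := h
    rw [Nat.mul_div_cancel_left m (Nat.pos_of_ne_zero hd)]
    convert (WithPiTopology.hasSum_iff_hasSum_coeff R).1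
      (WithPiTopology.hasSum_pentagonalSeries R) m using 2 with j
    rw [← map_intCast (C (R := R)), ← monomial_eq_C_mul_X_pow, coeff_monomial, coeff_monomial]
    simp [hd]
  · convert hasSum_zero using 2 with j
    rw [coeff_monomial, if_neg]
    rintro rfl
    exact h (dvd_mul_right d _)

variable [DiscreteTopology R]

theorem hasSum_monomial_mul {e e' : ℤ → ℕ} (he : ∀ j, |j| ≤ e j + 1) (he' : ∀ j, |j| ≤ e' j + 1)
    {u u' : ℤ → R} {F G : R⟦X⟧} (hF : HasSum (fun j ↦ monomial (e j) (u j)) F)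
    (hG : HasSum (fun j ↦ monomial (e' j) (u' j)) G) :
    HasSum (fun p : ℤ × ℤ ↦ monomial (e p.1 + e' p.2) (u p.1 * u' p.2)) (F * G) := by
  have h := hF.mul hG ((summable_monomial (finite_setOf_add_eq_of_abs_le he he')
    fun p ↦ u p.1 * u' p.2).congr fun p ↦ (monomial_mul_monomial _ _ _ _).symm)
  exact h.congr_fun fun p ↦ (monomial_mul_monomial _ _ _ _).symm

theorem eq_zero_of_hasSum_of_equiv [IsDomain R] (h2 : (2 : R) ≠ 0) {ι : Type*} {f : ι → R⟦X⟧}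
    {S : R⟦X⟧} (hf : HasSum f S) (σ : ι ≃ ι) (hσ : ∀ i, f (σ i) = -f i) : S = 0 := by
  have h : HasSum f (-S) := by
    rw [← σ.hasSum_iff]
    exact hf.neg.congr_fun hσ
  have h3 : (C 2 : R⟦X⟧) * S = 0 := by
    rw [map_ofNat]
    linear_combination hf.unique h
  exact (mul_eq_zero.1 h3).resolve_left fun h4 ↦ h2 (C_injective (by rw [h4, map_zero]))

theorem hasSum_add_three_of_injective {ι M : Type*} [AddCommMonoid M] [TopologicalSpace M]
    [ContinuousAdd M] {f : ι → M} {c : ι → ℤ} {i₀ i₁ i₂ : ι → ι} (h₀ : i₀.Injective)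
    (h₁ : i₁.Injective) (h₂ : i₂.Injective) (hr₀ : ∀ x, x ∈ Set.range i₀ ↔ c x % 3 = 0)
    (hr₁ : ∀ x, x ∈ Set.range i₁ ↔ c x % 3 = 1) (hr₂ : ∀ x, x ∈ Set.range i₂ ↔ c x % 3 = 2)
    {S₀ S₁ S₂ : M} (hS₀ : HasSum (f ∘ i₀) S₀) (hS₁ : HasSum (f ∘ i₁) S₁)
    (hS₂ : HasSum (f ∘ i₂) S₂) : HasSum f (S₀ + S₁ + S₂) := by
  have key {i : ι → ι} {r : ℤ} {S : M} (hi : i.Injective)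
      (hr : ∀ x, x ∈ Set.range i ↔ c x % 3 = r) (hS : HasSum (f ∘ i) S) :
      HasSum (fun x ↦ if c x % 3 = r then f x else 0) S := by
    refine (hi.hasSum_iff fun x hx ↦ if_neg ((hr x).not.1 hx)).1 (hS.congr_fun fun x ↦ ?_)
    exact if_pos ((hr _).1 (Set.mem_range_self x))
  refine (((key h₀ hr₀ hS₀).add (key h₁ hr₁ hS₁)).add (key h₂ hr₂ hS₂)).congr_fun fun x ↦ ?_
  have : c x % 3 = 0 ∨ c x % 3 = 1 ∨ c x % 3 = 2 := by omega
  rcases this with h | h | h <;> simp [h]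

theorem abs_le_pentagonal_neg_add_one (k : ℤ) : |k| ≤ pentagonal (-k) + 1 := by
  have := two_mul_natCast_pentagonal_neg k
  exact abs_le.2 ⟨by nlinarith, by nlinarith⟩

theorem abs_le_two_mul_pentagonal_add_one (k : ℤ) : |k| ≤ (2 * pentagonal k : ℕ) + 1 := by
  have := two_mul_natCast_pentagonal k
  push_cast
  exact abs_le.2 ⟨by nlinarith, by nlinarith⟩

theorem hasSum_triangular_add_sq [IsDomain R] (h2 : (2 : R) ≠ 0) {P : R⟦X⟧}
    (hP : HasSum (fun j : ℤ ↦ monomial (j.natAbs ^ 2) ((j.negOnePow : ℤ) : R)) P) :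
    HasSum (fun p : ℤ × ℤ ↦ monomial (triangular p.1 + p.2.natAbs ^ 2)
      (((p.1 + p.2).negOnePow : ℤ) * ((2 * p.2 - p.1 : ℤ) : R))) (pentagonalSeries R ^ 3 * P) := by
  obtain ⟨J, hJ⟩ := summable_monomial (finite_setOf_eq_of_abs_le abs_le_triangular_add_one)
    fun j ↦ ((j.negOnePow : ℤ) * j : R)
  obtain ⟨Z, hZ⟩ := summable_monomial (finite_setOf_eq_of_abs_le abs_le_triangular_add_one)
    fun j ↦ ((j.negOnePow : ℤ) : R)
  obtain ⟨B, hB⟩ := summable_monomial (finite_setOf_eq_of_abs_le abs_le_natAbs_sq_add_one)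
    fun j ↦ ((j.negOnePow : ℤ) * j : R)
  have hB0 : B = 0 := eq_zero_of_hasSum_of_equiv h2 hB (Equiv.neg ℤ) fun j ↦ by
    simp [Int.negOnePow_neg]
  have h := ((hasSum_monomial_mul abs_le_triangular_add_one abs_le_natAbs_sq_add_one hZ hB).mul_left
    (C 2)).sub (hasSum_monomial_mul abs_le_triangular_add_one abs_le_natAbs_sq_add_one hJ hP)
  rw [hB0, mul_zero, mul_zero, jacobi_pow_three hJ, zero_sub, neg_mul, neg_neg] at h
  refine h.congr_fun fun p ↦ ?_
  rw [← smul_eq_C_mul, ← map_smul, ← map_sub, Int.negOnePow_add]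
  congr 1
  push_cast
  rw [smul_eq_mul]
  ring

theorem negOnePow_cast_eq_of_even_sub (R : Type*) [CommRing R] {i j : ℤ} (h : Even (i - j)) :
    ((i.negOnePow : ℤ) : R) = (j.negOnePow : ℤ) := by
  rw [(Int.negOnePow_eq_iff i j).2 h]

theorem negOnePow_cast_eq_of_odd_sub (R : Type*) [CommRing R] {i j : ℤ} (h : Odd (i - j)) :
    ((i.negOnePow : ℤ) : R) = -(j.negOnePow : ℤ) := by
  rw [negOnePow_cast_eq_of_even_sub R (j := j + 1) (by grind), Int.negOnePow_succ]
  push_cast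
  rfl

theorem eq_mul_expand_of_hasSum_triangular_add_sq [IsDomain R] (h2 : (2 : R) ≠ 0)
    {f : ℤ × ℤ → R⟦X⟧} (hf : ∀ p, f p = monomial (triangular p.1 + p.2.natAbs ^ 2)
      (((p.1 + p.2).negOnePow : ℤ) * ((2 * p.2 - p.1 : ℤ) : R))) {S T : R⟦X⟧} (hS : HasSum f S)
    (hT : HasSum (fun k : ℤ ↦ monomial (pentagonal (-k)) ((6 * k + 1 : ℤ) : R)) T) :
    S = T * (pentagonalSeries R).expand 2 two_ne_zero := by
  let i₀ : ℤ × ℤ → ℤ × ℤ := fun p ↦ (2 * p.2 - p.1, p.2 + p.1)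
  let i₁ : ℤ × ℤ → ℤ × ℤ := fun p ↦ (2 * p.2 - p.1 - 1, p.2 + p.1)
  let i₂ : ℤ × ℤ → ℤ × ℤ := fun p ↦ (-2 * p.2 + p.1 + 1, -p.2 - p.1)
  have h₀ : i₀.Injective := fun p p' h ↦ by
    simp only [i₀, Prod.ext_iff] at h ⊢
    omega
  have h₁ : i₁.Injective := fun p p' h ↦ by
    simp only [i₁, Prod.ext_iff] at h ⊢
    omega
  have h₂ : i₂.Injective := fun p p' h ↦ by
    simp only [i₂, Prod.ext_iff] at h ⊢
    omega
  have hsum {i : ℤ × ℤ → ℤ × ℤ} (hi : i.Injective) : Summable (f ∘ i) :=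
    (summable_monomial (fun d ↦ (finite_setOf_add_eq_of_abs_le abs_le_triangular_add_one
      abs_le_natAbs_sq_add_one d).preimage (f := i) hi.injOn) _).congr fun p ↦ (hf (i p)).symm
  obtain ⟨S₀, hS₀⟩ := hsum h₀
  obtain ⟨S₁, hS₁⟩ := hsum h₁
  obtain ⟨S₂, hS₂⟩ := hsum h₂
  have hsplit := hasSum_add_three_of_injective (c := fun p ↦ 2 * p.2 - p.1) h₀ h₁ h₂
    (fun x ↦ ⟨by rintro ⟨p, rfl⟩; simp only [i₀]; omega, fun h ↦
      ⟨((2 * x.2 - x.1) / 3, x.2 - (2 * x.2 - x.1) / 3), by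
        simp only [i₀, Prod.ext_iff]; omega⟩⟩)
    (fun x ↦ ⟨by rintro ⟨p, rfl⟩; simp only [i₁]; omega, fun h ↦
      ⟨((2 * x.2 - x.1) / 3, x.2 - (2 * x.2 - x.1) / 3), by
        simp only [i₁, Prod.ext_iff]; omega⟩⟩)
    (fun x ↦ ⟨by rintro ⟨p, rfl⟩; simp only [i₂]; omega, fun h ↦
      ⟨(-((2 * x.2 - x.1) / 3) - 1, -x.2 + (2 * x.2 - x.1) / 3 + 1), by
        simp only [i₂, Prod.ext_iff]; omega⟩⟩) hS₀ hS₁ hS₂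
  have hS₁0 : S₁ = 0 := by
    refine eq_zero_of_hasSum_of_equiv h2 hS₁
      ((Equiv.refl ℤ).prodCongr (Equiv.subLeft 1)) fun ⟨k, j⟩ ↦ ?_
    have he : triangular (2 * (1 - j) - k - 1) + (1 - j + k).natAbs ^ 2 =
        triangular (2 * j - k - 1) + (j + k).natAbs ^ 2 := by
      zify
      refine mul_left_cancel₀ two_ne_zero (M₀ := ℤ) ?_
      simp only [mul_add, two_mul_natCast_triangular, sq_abs]
      ring
    have hn := negOnePow_cast_eq_of_odd_sub R (i := 2 * (1 - j) - k - 1 + (1 - j + k))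
      (j := 2 * j - k - 1 + (j + k)) (by grind)
    simp only [Function.comp_apply, hf, i₁, Equiv.prodCongr_apply, Prod.map_apply,
      Equiv.refl_apply, Equiv.subLeft_apply, he, hn, ← map_neg]
    congr 1
    push_cast
    ring
  have hS₀₂ : S₀ + S₂ = T * (pentagonalSeries R).expand 2 two_ne_zero := by
    refine (hS₀.add hS₂).unique ((hasSum_monomial_mul abs_le_pentagonal_neg_add_one
      abs_le_two_mul_pentagonal_add_one hT
      (hasSum_expand_pentagonalSeries two_ne_zero)).congr_fun fun p ↦ ?_)
    have he₀ : triangular (2 * p.2 - p.1) + (p.2 + p.1).natAbs ^ 2 =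
        pentagonal (-p.1) + 2 * pentagonal p.2 := by
      zify
      refine mul_left_cancel₀ two_ne_zero (M₀ := ℤ) ?_
      simp only [mul_add, two_mul_natCast_triangular, two_mul_natCast_pentagonal, sq_abs]
      ring
    have he₂ : triangular (-2 * p.2 + p.1 + 1) + (-p.2 - p.1).natAbs ^ 2 =
        pentagonal (-p.1) + 2 * pentagonal p.2 := by
      zify
      refine mul_left_cancel₀ two_ne_zero (M₀ := ℤ) ?_
      simp only [mul_add, two_mul_natCast_triangular, two_mul_natCast_pentagonal, sq_abs]
      ring
    have hn₀ := negOnePow_cast_eq_of_even_sub R (i := 2 * p.2 - p.1 + (p.2 + p.1)) (j := p.2)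
      (by grind)
    have hn₂ := negOnePow_cast_eq_of_odd_sub R (i := -2 * p.2 + p.1 + 1 + (-p.2 - p.1))
      (j := p.2) (by grind)
    simp only [Function.comp_apply, hf, i₀, i₂, he₀, he₂, hn₀, hn₂, ← map_add]
    congr 1
    push_cast
    ring
  rw [← hS₀₂, hS.unique hsplit, hS₁0, add_zero]

/-- A derivative form of the quintuple product identity. -/
theorem quintuple_mul [IsDomain R] (h2 : (2 : R) ≠ 0) {T : R⟦X⟧}
    (hT : HasSum (fun k : ℤ ↦ monomial (pentagonal (-k)) ((6 * k + 1 : ℤ) : R)) T) :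
    T * (pentagonalSeries R).expand 2 two_ne_zero ^ 2 = pentagonalSeries R ^ 5 := by
  obtain ⟨P, hP⟩ := summable_monomial (finite_setOf_eq_of_abs_le abs_le_natAbs_sq_add_one)
    fun j ↦ ((j.negOnePow : ℤ) : R)
  have h := eq_mul_expand_of_hasSum_triangular_add_sq h2 (fun _ ↦ rfl)
    (hasSum_triangular_add_sq h2 hP) hT
  rw [sq, ← mul_assoc, ← h, mul_assoc, gauss_theta_mul hP]
  ring

end Quintuple
section Final

open scoped PowerSeries.WithPiTopology

theorem six_mul_add_one_cast_eq_zero {m k : ℤ}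
    (h : (pentagonal (-m) + pentagonal (-k)) % 11 = 10) : ((6 * m + 1 : ℤ) : ZMod 11) = 0 := by
  have hm := two_mul_natCast_pentagonal_neg m
  have hk := two_mul_natCast_pentagonal_neg k
  have h1 : ((11 * ((pentagonal (-m) + pentagonal (-k)) / 11) + 10 : ℕ) : ZMod 11) =
      ((pentagonal (-m) : ℤ) + (pentagonal (-k) : ℤ) : ℤ) := by
    rw [← h, Nat.div_add_mod]
    push_cast
    rfl
  have hm' := congrArg (Int.cast : ℤ → ZMod 11) hm
  have hk' := congrArg (Int.cast : ℤ → ZMod 11) hk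
  have h11 : (11 : ZMod 11) = 0 := rfl
  push_cast at h1 hm' hk' ⊢
  have key : ∀ x y : ZMod 11, (6 * x + 1) ^ 2 + (6 * y + 1) ^ 2 = 0 → 6 * x + 1 = 0 := by decide
  refine key m k ?_
  have : (242 : ZMod 11) = 0 := rfl
  linear_combination (-12 : ZMod 11) * hm' - 12 * hk' - 24 * h1 + this +
    24 * ((pentagonal (-m) + pentagonal (-k)) / 11 : ℕ) * h11

theorem coeff_sq_eq_zero [TopologicalSpace (ZMod 11)] [DiscreteTopology (ZMod 11)]
    {T : (ZMod 11)⟦X⟧}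
    (hT : HasSum (fun k : ℤ ↦ monomial (pentagonal (-k)) ((6 * k + 1 : ℤ) : ZMod 11)) T)
    {d : ℕ} (hd : d % 11 = 10) : coeff d (T ^ 2) = 0 := by
  rw [sq]
  refine ((WithPiTopology.hasSum_iff_hasSum_coeff _).1 (hasSum_monomial_mul
    abs_le_pentagonal_neg_add_one abs_le_pentagonal_neg_add_one hT hT) d).unique ?_
  convert hasSum_zero using 2 with p
  rw [coeff_monomial]
  split_ifs with h
  · rw [six_mul_add_one_cast_eq_zero (h ▸ hd), zero_mul]
  · rfl

theorem expand_eq_pow_prime {p : ℕ} [Fact p.Prime] (f : (ZMod p)⟦X⟧) :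
    f.expand p (Fact.out : p.Prime).ne_zero = f ^ p := by
  have h := MvPowerSeries.map_frobenius_expand p (Fact.out : p.Prime).ne_zero (f := f)
  rwa [ZMod.frobenius_zmod, MvPowerSeries.map_id] at h

end Final

/-- For all `n ≥ 0`, `a_5(11n+10) ≡ 0 (mod 11)`. -/
theorem a5_11n10_mod11 (n : ℕ) : 11 ∣ a 5 (11 * n + 10) := by
  have : Fact (Nat.Prime 11) := ⟨by norm_num⟩
  let : TopologicalSpace (ZMod 11) := ⊥
  have : DiscreteTopology (ZMod 11) := ⟨rfl⟩
  rw [← ZMod.natCast_eq_zero_iff]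
  obtain ⟨T, hT⟩ := summable_monomial (finite_setOf_eq_of_abs_le abs_le_pentagonal_neg_add_one)
    fun k ↦ ((6 * k + 1 : ℤ) : ZMod 11)
  have h : (mk fun n ↦ (a 5 n : ZMod 11)) =
      T ^ 2 * (partitionSeries (ZMod 11)).expand 11 (by decide) := by
    rw [expand_eq_pow_prime]
    have h1 := quintuple_mul (by decide) hT
    have h2 := mk_a_five_mul (ZMod 11)
    have h3 := congrArg (· ^ 11) (partitionSeries_mul_pentagonalSeries (ZMod 11))
    have h4 := congrArg (· ^ 2) h1
    simp only [mul_pow, one_pow, ← pow_mul, Nat.reduceMul] at h3 h4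
    linear_combination (-mk fun n ↦ (a 5 n : ZMod 11)) * h3 - partitionSeries (ZMod 11) ^ 11 *
      (mk fun n ↦ (a 5 n : ZMod 11)) * pentagonalSeries (ZMod 11) * h4 +
      partitionSeries (ZMod 11) ^ 11 * T ^ 2 * h2
  rw [← coeff_mk (R := ZMod 11) (11 * n + 10) fun n ↦ (a 5 n : ZMod 11), h, coeff_mul]
  refine Finset.sum_eq_zero fun x hx ↦ ?_
  rw [Finset.HasAntidiagonal.mem_antidiagonal] at hx
  rw [coeff_expand]
  split_ifs with h11
  · rw [coeff_sq_eq_zero hT (by omega), zero_mul]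
  · rw [mul_zero]
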